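/- For every tropically regular matrix A ∈ M_n(𝕋), the products A ⊙ A^∇ and A^∇ ⊙ A are idempotent: (A ⊙ A^∇) ⊙ (A ⊙ A^∇) = A ⊙ A^∇ and (A^∇ ⊙ A) ⊙ (A^∇ ⊙ A) = A^∇ ⊙ A. -/

import Mathlib

/-- The extended tropical semiring `𝕋 = ℝ ∪ {−∞} ∪ ℝ^ν`:
`neginf` is `−∞`, `real a` is the real (tangible) element `a`,
and `ghost a` is the ghost element `a^ν`. -/
inductive T : Type where
  | neginf : T
  | real : ℝ → T
  | ghost : ℝ → T

namespace T

/-- Tropical addition `⊕` on `𝕋`. -/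
noncomputable def add : T → T → T
  | neginf, x => x
  | real a, neginf => real a
  | ghost a, neginf => ghost a
  | real a, real b => if a < b then real b else if b < a then real a else ghost a
  | real a, ghost b => if a ≤ b then ghost b else real a
  | ghost a, real b => if b ≤ a then ghost a else real b
  | ghost a, ghost b => if a < b then ghost b else ghost a

/-- Tropical multiplication `⊙` on `𝕋`. -/
noncomputable def mul : T → T → T
  | neginf, _ => neginf
  | real _, neginf => neginf
  | ghost _, neginf => neginf
  | real a, real b => real (a + b)
  | real a, ghost b => ghost (a + b)
  | ghost a, real b => ghost (a + b)
  | ghost a, ghost b => ghost (a + b)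

/-- The strict order `≺` on `𝕋`. -/
def lt : T → T → Prop
  | neginf, neginf => False
  | neginf, real _ => True
  | neginf, ghost _ => True
  | real _, neginf => False
  | ghost _, neginf => False
  | real a, real b => a < b
  | real a, ghost b => a ≤ b
  | ghost a, real b => a < b
  | ghost a, ghost b => a < b

/-- The order `⪯` on `𝕋`: `x ⪯ y` iff `x = y` or `x ≺ y`. -/
def le (x y : T) : Prop := x = y ∨ lt x y

/-- Membership in `ℝ̄^ν = ℝ^ν ∪ {−∞}` (the ghost elements together with `−∞`). -/
def isGhost : T → Prop
  | neginf => True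
  | real _ => False
  | ghost _ => True

/-- Membership in `ℝ` (the real, tangible elements). -/
def isReal : T → Prop
  | neginf => False
  | real _ => True
  | ghost _ => False

/-- The ghost map `ν : 𝕋 → ℝ̄^ν`. -/
def nu : T → T
  | neginf => neginf
  | real a => ghost a
  | ghost a => ghost a

/-- The projection `π : 𝕋 → ℝ ∪ {−∞}` onto the max-plus semiring `(ℝ ∪ {−∞}, max, +)`,
realized as `WithBot ℝ`. -/
def pi : T → WithBot ℝ
  | neginf => ⊥
  | real a => (a : WithBot ℝ)
  | ghost a => (a : WithBot ℝ)

/-- The embedding `θ : (ℝ ∪ {−∞}, max, +) → 𝕋`, `a ↦ a^ν`, `−∞ ↦ −∞`. -/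
def theta : WithBot ℝ → T :=
  fun x => WithBot.recBotCoe neginf (fun a => ghost a) x

/-- `pow x n` is the `n`-fold tropical product `x ⊙ x ⊙ ⋯ ⊙ x` (with `pow x 0 = 0`, the one). -/
noncomputable def pow (x : T) : ℕ → T
  | 0 => real 0
  | n + 1 => mul x (pow x n)

instance : Std.Commutative add := ⟨by
  intro x y
  cases x <;> cases y <;> simp only [add] <;> split_ifs <;>
    first | rfl | (exfalso; linarith) | (congr 1; linarith)⟩

instance : Std.Associative add := ⟨by
  intro x y z
  cases x <;> cases y <;> cases z <;>
    simp only [add] <;>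
    repeat' (first | split_ifs | simp only [add]) 
  all_goals first | rfl | (exfalso; linarith) | (congr 1; linarith)⟩

instance : Std.Commutative mul := ⟨by
  intro x y
  cases x <;> cases y <;> simp only [mul] <;> congr 1 <;> ring⟩

instance : Std.Associative mul := ⟨by
  intro x y z
  cases x <;> cases y <;> cases z <;> simp only [mul] <;> congr 1 <;> ring⟩

/-- Finite tropical sum `⊕` over a finite index set. -/
noncomputable def sumT {ι : Type*} (s : Finset ι) (f : ι → T) : T := s.fold add neginf f

/-- Finite tropical product `⊙` over a finite index set. -/
noncomputable def prodT {ι : Type*} (s : Finset ι) (f : ι → T) : T := s.fold mul (real 0) f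

/-- Tropical matrix multiplication over `𝕋`. -/
noncomputable def matMul {n : ℕ} (A B : Matrix (Fin n) (Fin n) T) : Matrix (Fin n) (Fin n) T :=
  fun i j => sumT Finset.univ fun k => mul (A i k) (B k j)

/-- The tropical determinant (permanent) `|A| = ⊕_{σ ∈ S_n} a_{1σ(1)} ⊙ ⋯ ⊙ a_{nσ(n)}`. -/
noncomputable def det {n : ℕ} (A : Matrix (Fin n) (Fin n) T) : T :=
  sumT Finset.univ fun σ : Equiv.Perm (Fin n) => prodT Finset.univ fun i => A i (σ i)

/-- `A` is tropically regular if `|A| ∈ ℝ`. -/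
def regular {n : ℕ} (A : Matrix (Fin n) (Fin n) T) : Prop := isReal (det A)

/-- `A` is tropically singular if `|A| ∈ ℝ̄^ν`. -/
def singular {n : ℕ} (A : Matrix (Fin n) (Fin n) T) : Prop := isGhost (det A)

/-- The minor `A_{ij}`: delete row `i` and column `j`. -/
noncomputable def minor {n : ℕ} (A : Matrix (Fin (n+1)) (Fin (n+1)) T) (i j : Fin (n+1)) :
    Matrix (Fin n) (Fin n) T :=
  A.submatrix i.succAbove j.succAbove

/-- The adjoint matrix `Adj(A)`, the transpose of the matrix of minors' determinants. -/
noncomputable def adj {n : ℕ} (A : Matrix (Fin (n+1)) (Fin (n+1)) T) :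
    Matrix (Fin (n+1)) (Fin (n+1)) T :=
  fun i j => det (minor A j i)

/-- The `⊙`-inverse `x^{-1}` (only meaningful away from `−∞`): `a ↦ −a`, `a^ν ↦ (−a)^ν`. -/
def dinv : T → T
  | neginf => neginf
  | real a => real (-a)
  | ghost a => ghost (-a)

/-- The pseudo inverse `A^∇ = Adj(A) ⊙ |A|^{-1}`. -/
noncomputable def pinv {n : ℕ} (A : Matrix (Fin (n+1)) (Fin (n+1)) T) :
    Matrix (Fin (n+1)) (Fin (n+1)) T :=
  fun i j => mul (adj A i j) (dinv (det A))

/-- A pseudo unit matrix: tropically regular, `0` on the diagonal,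
and ghosts (or `−∞`) off the diagonal. -/
def pseudoUnit {n : ℕ} (E : Matrix (Fin n) (Fin n) T) : Prop :=
  regular E ∧ (∀ i, E i i = real 0) ∧ ∀ i j, i ≠ j → isGhost (E i j)

/-- `A` is pseudo invertible if `A ⊙ B` and `B ⊙ A` are pseudo units for some `B`. -/
def pseudoInvertible {n : ℕ} (A : Matrix (Fin n) (Fin n) T) : Prop :=
  ∃ B, pseudoUnit (matMul A B) ∧ pseudoUnit (matMul B A)

/-- The ray/point `P_x ⊆ ℝ ∪ {−∞}` assigned to `x ∈ 𝕋`: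
`P_{−∞} = {−∞}`, `P_a = {a}`, `P_{a^ν} = [−∞, a]`. -/
def P : T → Set (WithBot ℝ)
  | neginf => {⊥}
  | real a => {(a : WithBot ℝ)}
  | ghost a => {t | t ≤ (a : WithBot ℝ)}

end T

namespace T

noncomputable instance : CommSemiring T where
  add := add
  mul := mul
  zero := neginf
  one := real 0
  add_assoc := Std.Associative.assoc (op := add)
  add_comm := Std.Commutative.comm (op := add)
  mul_assoc := Std.Associative.assoc (op := mul)
  mul_comm := Std.Commutative.comm (op := mul)
  zero_add _ := rfl
  add_zero x := by cases x <;> rfl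
  one_mul x := by
    change mul (real 0) x = x
    cases x <;> simp [mul]
  mul_one x := by
    change mul x (real 0) = x
    cases x <;> simp [mul]
  zero_mul _ := rfl
  mul_zero x := by cases x <;> rfl
  left_distrib x y z := by
    change mul x (add y z) = add (mul x y) (mul x z)
    cases x <;> cases y <;> cases z <;> simp only [add, mul] <;> (try split_ifs) <;>
      simp_all <;> linarith
  right_distrib x y z := by
    change mul (add x y) z = add (mul x z) (mul y z)
    cases x <;> cases y <;> cases z <;> simp only [add, mul] <;> (try split_ifs) <;>
      simp_all <;> linarith
  nsmul := @nsmulRec T ⟨neginf⟩ ⟨add⟩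

lemma add_def (x y : T) : x + y = add x y := rfl
lemma mul_def (x y : T) : x * y = mul x y := rfl
lemma zero_def : (0 : T) = neginf := rfl
lemma one_def : (1 : T) = real 0 := rfl

lemma sumT_eq_sum {ι : Type*} (s : Finset ι) (f : ι → T) : sumT s f = ∑ i ∈ s, f i := by
  classical
  induction s using Finset.induction_on with
  | empty => rfl
  | insert a s ha ih => rw [Finset.sum_insert ha, ← ih, sumT, Finset.fold_insert ha]; rfl

lemma prodT_eq_prod {ι : Type*} (s : Finset ι) (f : ι → T) : prodT s f = ∏ i ∈ s, f i := by
  classical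
  induction s using Finset.induction_on with
  | empty => rfl
  | insert a s ha ih => rw [Finset.prod_insert ha, ← ih, prodT, Finset.fold_insert ha]; rfl

lemma matMul_eq_mul {n : ℕ} (A B : Matrix (Fin n) (Fin n) T) : matMul A B = A * B := by
  ext i j
  rw [Matrix.mul_apply, matMul, sumT_eq_sum]
  rfl

lemma det_eq_sum {n : ℕ} (A : Matrix (Fin n) (Fin n) T) :
    det A = ∑ σ : Equiv.Perm (Fin n), ∏ i, A i (σ i) := by
  simp only [det, sumT_eq_sum, prodT_eq_prod]

lemma det_transpose {n : ℕ} (A : Matrix (Fin n) (Fin n) T) : det A.transpose = det A := by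
  simp only [det_eq_sum]
  exact (Matrix.permanent_transpose A).symm

/-! ### The projection to the max-plus semiring -/

lemma pi_add (x y : T) : pi (x + y) = pi x ⊔ pi y := by
  rw [add_def]
  cases x <;> cases y <;> simp only [add] <;> (try split_ifs) <;>
    simp [pi, ← WithBot.coe_sup] <;> linarith

lemma pi_mul (x y : T) : pi (x * y) = pi x + pi y := by
  rw [mul_def]
  cases x <;> cases y <;> simp [mul, pi]

lemma pi_sum {ι : Type*} (s : Finset ι) (f : ι → T) :
    pi (∑ i ∈ s, f i) = s.sup fun i => pi (f i) := by
  classical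
  induction s using Finset.induction_on with
  | empty => rfl
  | insert a s ha ih => rw [Finset.sum_insert ha, Finset.sup_insert, pi_add, ih]

lemma pi_prod {ι : Type*} (s : Finset ι) (f : ι → T) :
    pi (∏ i ∈ s, f i) = ∑ i ∈ s, pi (f i) := by
  classical
  induction s using Finset.induction_on with
  | empty => rfl
  | insert a s ha ih => rw [Finset.prod_insert ha, Finset.sum_insert ha, pi_mul, ih]

lemma add_eq_left_of_pi_lt {x y : T} (h : pi y < pi x) : x + y = x := by
  rw [add_def]
  cases x <;> cases y <;> simp_all [add, pi] <;> (try intro) <;> linarith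

lemma add_eq_left_of_isGhost {x y : T} (hx : isGhost x) (h : pi y ≤ pi x) : x + y = x := by
  rw [add_def]
  cases x <;> cases y <;> simp_all [add, pi, isGhost]

lemma add_eq_real {x y : T} {a : ℝ} (h : x + y = real a) :
    (x = real a ∧ pi y < a) ∨ (y = real a ∧ pi x < a) := by
  rw [add_def] at h
  cases x <;> cases y <;> simp only [add] at h <;> (try split_ifs at h) <;>
    simp_all [pi]

lemma exists_of_sum_eq_real {ι : Type*} {s : Finset ι} {f : ι → T} {a : ℝ}
    (h : ∑ i ∈ s, f i = real a) :
    ∃ i ∈ s, f i = real a ∧ ∀ j ∈ s, j ≠ i → pi (f j) < a := by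
  classical
  induction s using Finset.induction_on with
  | empty => simp [zero_def] at h
  | insert b s hb ih =>
    rw [Finset.sum_insert hb] at h
    rcases add_eq_real h with ⟨h1, h2⟩ | ⟨h1, h2⟩
    · refine ⟨b, Finset.mem_insert_self _ _, h1, fun j hj hjb => ?_⟩
      rw [pi_sum] at h2
      exact (Finset.le_sup (f := fun i => pi (f i))
        (Finset.mem_of_mem_insert_of_ne hj hjb)).trans_lt h2
    · obtain ⟨i, hi, hfi, hlt⟩ := ih h1
      refine ⟨i, Finset.mem_insert_of_mem hi, hfi, fun j hj hji => ?_⟩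
      rcases Finset.mem_insert.1 hj with rfl | hj
      · exact h2
      · exact hlt j hj hji

lemma isGhost_of_forall_ne_real {x : T} (h : ∀ a, x ≠ real a) : isGhost x := by
  cases x <;> simp_all [isGhost]

/-! ### Laplace expansion -/

/-- The permutation sending `j` to `k` and acting as `τ` on the complements. -/
def permInsert {n : ℕ} (j k : Fin (n + 1)) (τ : Equiv.Perm (Fin n)) :
    Equiv.Perm (Fin (n + 1)) :=
  ((finSuccEquiv' j).trans τ.optionCongr).trans (finSuccEquiv' k).symm

lemma permInsert_self {n : ℕ} (j k : Fin (n + 1)) (τ : Equiv.Perm (Fin n)) :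
    permInsert j k τ j = k := by
  simp [permInsert]

lemma permInsert_succAbove {n : ℕ} (j k : Fin (n + 1)) (τ : Equiv.Perm (Fin n)) (r : Fin n) :
    permInsert j k τ (j.succAbove r) = k.succAbove (τ r) := by
  simp [permInsert]

lemma permInsert_bijective {n : ℕ} (j : Fin (n + 1)) :
    Function.Bijective fun p : Fin (n + 1) × Equiv.Perm (Fin n) => permInsert j p.1 p.2 := by
  rw [Fintype.bijective_iff_injective_and_card]
  constructor
  · rintro ⟨k, τ⟩ ⟨k', τ'⟩ h
    have h' : ∀ r, permInsert j k τ r = permInsert j k' τ' r := fun r => by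
      exact congrArg (fun σ : Equiv.Perm (Fin (n + 1)) => σ r) h
    have hk : k = k' := by simpa [permInsert_self] using h' j
    subst hk
    refine Prod.ext rfl (Equiv.ext fun r => ?_)
    simpa [permInsert_succAbove] using h' (j.succAbove r)
  · simp [Fintype.card_perm, Nat.factorial_succ]

/-- The determinant of `A` with row `j` replaced by row `i`. -/
noncomputable def replaceDet {n : ℕ} (A : Matrix (Fin n) (Fin n) T) (i j : Fin n) : T :=
  ∑ σ : Equiv.Perm (Fin n), ∏ r, A (Function.update id j i r) (σ r)

lemma replaceDet_self {n : ℕ} (A : Matrix (Fin n) (Fin n) T) (i : Fin n) :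
    replaceDet A i i = det A := by
  have h : Function.update id i i = (id : Fin n → Fin n) := Function.update_eq_self i id
  simp only [replaceDet, det_eq_sum, h, id]

lemma sum_mul_adj {n : ℕ} (A : Matrix (Fin (n + 1)) (Fin (n + 1)) T) (i j : Fin (n + 1)) :
    ∑ k, A i k * adj A k j = replaceDet A i j := by
  rw [replaceDet, ← (permInsert_bijective j).sum_comp, Fintype.sum_prod_type]
  refine Finset.sum_congr rfl fun k _ => ?_
  rw [adj, det_eq_sum, Finset.mul_sum]
  refine Finset.sum_congr rfl fun τ _ => ?_
  rw [Fin.prod_univ_succAbove _ j]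
  simp [permInsert_self, permInsert_succAbove, minor, Fin.succAbove_ne]

lemma mul_pinv_apply {n : ℕ} (A : Matrix (Fin (n + 1)) (Fin (n + 1)) T) (i j : Fin (n + 1)) :
    (A * pinv A) i j = replaceDet A i j * dinv (det A) := by
  rw [Matrix.mul_apply, ← sum_mul_adj, Finset.sum_mul]
  exact Finset.sum_congr rfl fun k _ => (mul_assoc _ _ _).symm

lemma isGhost_replaceDet {n : ℕ} (A : Matrix (Fin n) (Fin n) T) {i j : Fin n} (hij : i ≠ j) :
    isGhost (replaceDet A i j) := by
  refine isGhost_of_forall_ne_real fun a h => ?_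
  obtain ⟨σ, -, hσ, hlt⟩ := exists_of_sum_eq_real h
  have hne : (Equiv.swap i j).trans σ ≠ σ := fun h => hij <| by
    simpa using congrArg (fun τ : Equiv.Perm (Fin n) => σ.symm (τ j)) h
  have hupd : ∀ r, Function.update id j i (Equiv.swap i j r) = Function.update id j i r := by
    intro r
    rcases eq_or_ne r i with rfl | hri
    · simp [hij]
    rcases eq_or_ne r j with rfl | hrj
    · simp [hij]
    · rw [Equiv.swap_apply_of_ne_of_ne hri hrj]
  have heq : ∏ r, A (Function.update id j i r) (((Equiv.swap i j).trans σ) r) =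
      ∏ r, A (Function.update id j i r) (σ r) := by
    rw [← Equiv.prod_comp (Equiv.swap i j) fun r => A (Function.update id j i r) (σ r)]
    exact Finset.prod_congr rfl fun r _ => by rw [hupd]; rfl
  have := hlt _ (Finset.mem_univ _) hne
  rw [heq, hσ] at this
  exact lt_irrefl _ this

end T

/-! ### Exchange of assignments -/

section Exchange

variable {ι : Type*} [Fintype ι] [DecidableEq ι]

/-- `f` takes every value once, except that it takes `i` once more and `j` once less. -/
def IsDefectPerm (i j : ι) (f : ι → ι) : Prop :=
  ∀ r, (∑ c, if f c = r then 1 else 0) + (if r = j then 1 else 0) =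
    1 + (if r = i then 1 else 0)

lemma isDefectPerm_update_comp (i j : ι) (σ : Equiv.Perm ι) :
    IsDefectPerm i j (Function.update id j i ∘ σ) := by
  intro r
  rw [Function.comp_def, Equiv.sum_comp σ fun s => if Function.update id j i s = r then 1 else 0]
  have h1 : ∑ s, (if s = r then 1 else 0) = 1 := by simp
  rw [← Finset.add_sum_erase _ _ (Finset.mem_univ j)] at h1 ⊢
  have h2 : ∑ s ∈ Finset.univ.erase j, (if Function.update id j i s = r then 1 else 0) =
      ∑ s ∈ Finset.univ.erase j, if s = r then 1 else 0 :=
    Finset.sum_congr rfl fun s hs => by simp [Finset.ne_of_mem_erase hs]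
  rw [h2]
  simp only [Function.update_self, eq_comm (a := r)]
  omega

lemma isDefectPerm_self_iff {i : ι} {f : ι → ι} :
    IsDefectPerm i i f ↔ Function.Bijective f := by
  constructor
  · intro h
    refine Function.Surjective.bijective_of_finite fun r => ?_
    by_contra! hr
    have := h r
    simp [hr] at this
  · intro h
    have h' := isDefectPerm_update_comp i i (Equiv.ofBijective f h)
    rwa [show Function.update id i i = id from Function.update_eq_self i id] at h'

lemma IsDefectPerm.exists_perm {i j : ι} {f : ι → ι} (h : IsDefectPerm i j f) :
    ∃ σ : Equiv.Perm ι, f = Function.update id j i ∘ σ := by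
  rcases eq_or_ne i j with rfl | hij
  · exact ⟨Equiv.ofBijective f (isDefectPerm_self_iff.1 h), by
      rw [show Function.update id i i = id from Function.update_eq_self i id]; rfl⟩
  have hi : 1 < (Finset.univ.filter fun c => f c = i).card := by
    have := h i
    rw [Finset.card_filter]
    simp [hij] at this ⊢
    omega
  obtain ⟨c₀, hc₀, c₁, hc₁, hne⟩ := Finset.one_lt_card.1 hi
  simp only [Finset.mem_filter, Finset.mem_univ, true_and] at hc₀ hc₁
  have hj : ∀ c, f c ≠ j := by
    have := h j
    simpa [hij.symm, Finset.filter_eq_empty_iff] using this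
  have hsurj : Function.Surjective (Function.update f c₀ j) := by
    intro r
    rcases eq_or_ne r j with rfl | hrj
    · exact ⟨c₀, by simp⟩
    rcases eq_or_ne r i with rfl | hri
    · exact ⟨c₁, by simp [hne.symm, hc₁]⟩
    by_contra! hr
    have hf : ∀ c, f c ≠ r := by
      intro c hc
      have : c ≠ c₀ := by rintro rfl; exact hri (hc.symm.trans hc₀)
      exact hr c (by simp [this, hc])
    have := h r
    simp [hf, hrj, hri] at this
  refine ⟨Equiv.ofBijective _ hsurj.bijective_of_finite, ?_⟩
  ext c
  rcases eq_or_ne c c₀ with rfl | hc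
  · simp [hc₀]
  · simp [hc, hj]

lemma IsDefectPerm.exchange {i j k : ι} {f g : ι → ι}
    (hf : IsDefectPerm i k f) (hg : IsDefectPerm k j g) :
    ∃ h h' : ι → ι, Function.Bijective h ∧ IsDefectPerm i j h' ∧
      ∀ c, (h c = f c ∧ h' c = g c) ∨ (h c = g c ∧ h' c = f c) := by
  have hall : ∀ s : Finset ι, s.card ≤ (s.biUnion fun c => {f c, g c}).card := by
    intro s
    set N := s.biUnion fun c => ({f c, g c} : Finset ι) with hN
    have hcount : ∀ e : ι → ι, (∀ c ∈ s, e c ∈ N) →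
        s.card ≤ ∑ r ∈ N, ∑ c, if e c = r then 1 else 0 := by
      intro e he
      rw [Finset.card_eq_sum_card_fiberwise he]
      refine Finset.sum_le_sum fun r _ => ?_
      rw [← Finset.card_filter]
      exact Finset.card_le_card (Finset.filter_subset_filter _ (Finset.subset_univ s))
    have h1 := hcount f fun c hc => Finset.mem_biUnion.2 ⟨c, hc, by simp⟩
    have h2 := hcount g fun c hc => Finset.mem_biUnion.2 ⟨c, hc, by simp⟩
    have h3 : ∑ r ∈ N, ((∑ c, if f c = r then 1 else 0) + ∑ c, if g c = r then 1 else 0) ≤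
        ∑ r ∈ N, (2 + if r = i then 1 else 0) :=
      Finset.sum_le_sum fun r _ => by
        have := hf r
        have := hg r
        omega
    have h4 : ∑ r ∈ N, (2 + if r = i then 1 else 0) ≤ 2 * N.card + 1 := by
      rw [Finset.sum_add_distrib, Finset.sum_const, Finset.sum_ite_eq', smul_eq_mul, mul_comm]
      split_ifs <;> omega
    rw [Finset.sum_add_distrib] at h3
    omega
  obtain ⟨h, hinj, hmem⟩ := (Finset.all_card_le_biUnion_card_iff_exists_injective _).1 hall
  have hbij : Function.Bijective h := hinj.bijective_of_finite
  have hcases : ∀ c, (h c = f c ∧ (if h c = f c then g c else f c) = g c) ∨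
      (h c = g c ∧ (if h c = f c then g c else f c) = f c) := by
    intro c
    have := hmem c
    simp only [Finset.mem_insert, Finset.mem_singleton] at this
    by_cases hc : h c = f c
    · simp [hc]
    · simp [this.resolve_left hc]
  refine ⟨h, fun c => if h c = f c then g c else f c, hbij, fun r => ?_, hcases⟩
  have h1 := hf r
  have h2 := hg r
  have h3 := (isDefectPerm_self_iff (i := i)).2 hbij r
  have h4 : (∑ c, if h c = r then 1 else 0) +
      (∑ c, if (if h c = f c then g c else f c) = r then 1 else 0) =
      (∑ c, if f c = r then 1 else 0) + ∑ c, if g c = r then 1 else 0 := by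
    rw [← Finset.sum_add_distrib, ← Finset.sum_add_distrib]
    refine Finset.sum_congr rfl fun c _ => ?_
    rcases hcases c with ⟨ha, hb⟩ | ⟨ha, hb⟩
    · rw [hb, ha]
    · rw [hb, ha, add_comm]
  beta_reduce
  omega

end Exchange

namespace T

/-- The max-plus weight of an assignment of a row to each column. -/
noncomputable def weight {n : ℕ} (A : Matrix (Fin n) (Fin n) T) (f : Fin n → Fin n) :
    WithBot ℝ :=
  ∑ c, pi (A (f c) c)

lemma weight_comp_symm {n : ℕ} (A : Matrix (Fin n) (Fin n) T) (φ : Fin n → Fin n)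
    (σ : Equiv.Perm (Fin n)) : weight A (φ ∘ σ.symm) = pi (∏ r, A (φ r) (σ r)) := by
  rw [pi_prod, weight, ← Equiv.sum_comp σ]
  simp

lemma weight_add_weight_of_exchange {n : ℕ} (A : Matrix (Fin n) (Fin n) T)
    {f g h h' : Fin n → Fin n}
    (hc : ∀ c, (h c = f c ∧ h' c = g c) ∨ (h c = g c ∧ h' c = f c)) :
    weight A f + weight A g = weight A h + weight A h' := by
  simp only [weight, ← Finset.sum_add_distrib]
  refine Finset.sum_congr rfl fun c _ => ?_
  rcases hc c with ⟨ha, hb⟩ | ⟨ha, hb⟩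
  · rw [ha, hb]
  · rw [ha, hb, add_comm]

lemma exists_weight_eq_pi_replaceDet {n : ℕ} (A : Matrix (Fin n) (Fin n) T) (i j : Fin n) :
    ∃ f, IsDefectPerm i j f ∧ weight A f = pi (replaceDet A i j) := by
  obtain ⟨σ, -, hσ⟩ := Finset.exists_mem_eq_sup (Finset.univ : Finset (Equiv.Perm (Fin n)))
    Finset.univ_nonempty fun σ => pi (∏ r, A (Function.update id j i r) (σ r))
  exact ⟨_, isDefectPerm_update_comp i j σ.symm, by
    rw [weight_comp_symm, replaceDet, pi_sum, hσ]⟩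

lemma weight_le_pi_replaceDet {n : ℕ} (A : Matrix (Fin n) (Fin n) T) {i j : Fin n}
    {f : Fin n → Fin n} (hf : IsDefectPerm i j f) : weight A f ≤ pi (replaceDet A i j) := by
  obtain ⟨σ, rfl⟩ := hf.exists_perm
  rw [← σ.symm_symm, weight_comp_symm, replaceDet, pi_sum]
  exact Finset.le_sup (f := fun τ : Equiv.Perm (Fin n) =>
    pi (∏ r, A (Function.update id j i r) (τ r))) (Finset.mem_univ σ.symm)

lemma pi_replaceDet_add_le {n : ℕ} (A : Matrix (Fin n) (Fin n) T) (i j k : Fin n) :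
    pi (replaceDet A i k) + pi (replaceDet A k j) ≤ pi (det A) + pi (replaceDet A i j) := by
  obtain ⟨f, hf, hfw⟩ := exists_weight_eq_pi_replaceDet A i k
  obtain ⟨g, hg, hgw⟩ := exists_weight_eq_pi_replaceDet A k j
  obtain ⟨h, h', hh, hh', hc⟩ := hf.exchange hg
  rw [← hfw, ← hgw, weight_add_weight_of_exchange A hc, ← replaceDet_self A i]
  exact add_le_add (weight_le_pi_replaceDet A (isDefectPerm_self_iff.2 hh))
    (weight_le_pi_replaceDet A hh')

lemma exists_unique_optimal {n : ℕ} {A : Matrix (Fin n) (Fin n) T} {a : ℝ}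
    (hA : det A = real a) :
    ∃ p : Fin n → Fin n, ∀ h, Function.Bijective h → h ≠ p → weight A h < a := by
  rw [det_eq_sum] at hA
  obtain ⟨σ, -, -, hlt⟩ := exists_of_sum_eq_real hA
  refine ⟨σ.symm, fun h hh hne => ?_⟩
  have hw := weight_comp_symm A id (Equiv.ofBijective h hh).symm
  have : h = id ∘ (Equiv.ofBijective h hh).symm.symm := by ext; simp
  rw [← this] at hw
  rw [hw]
  refine hlt _ (Finset.mem_univ _) fun hσ => hne ?_
  rw [← hσ]
  rfl

lemma pi_replaceDet_add_lt {n : ℕ} {A : Matrix (Fin n) (Fin n) T} {a : ℝ}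
    (hA : det A = real a) {i k : Fin n} (hik : i ≠ k) :
    pi (replaceDet A i k) + pi (replaceDet A k i) < (a : WithBot ℝ) + a := by
  obtain ⟨f, hf, hfw⟩ := exists_weight_eq_pi_replaceDet A i k
  obtain ⟨g, hg, hgw⟩ := exists_weight_eq_pi_replaceDet A k i
  obtain ⟨h, h', hh, hh', hc⟩ := hf.exchange hg
  rw [← hfw, ← hgw, weight_add_weight_of_exchange A hc]
  obtain ⟨p, hp⟩ := exists_unique_optimal hA
  have hle : ∀ e, IsDefectPerm i i e → weight A e ≤ a := fun e he => by
    simpa [replaceDet_self, hA, pi] using weight_le_pi_replaceDet A he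
  by_cases h1 : h = p
  · by_cases h2 : h' = p
    · have hfh : f = h := by
        funext c
        rcases hc c with ⟨ha, hb⟩ | ⟨ha, hb⟩
        · exact ha.symm
        · rw [← hb, h1, h2]
      obtain ⟨c, hc⟩ := hh.surjective k
      have := hf k
      rw [hfh] at this
      simp [hik.symm] at this
      exact (this hc).elim
    · exact (add_le_add_left (hle h (isDefectPerm_self_iff.2 hh)) _).trans_lt
        (WithBot.add_lt_add_left (by simp) (hp h' (isDefectPerm_self_iff.1 hh') h2))
  · exact (add_le_add_right (hle h' hh') _).trans_lt
      (WithBot.add_lt_add_right (by simp) (hp h hh h1))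

lemma isIdempotentElem_mul_pinv {n : ℕ} {A : Matrix (Fin (n + 1)) (Fin (n + 1)) T}
    (hA : regular A) : IsIdempotentElem (A * pinv A) := by
  obtain ⟨a, ha⟩ : ∃ a, det A = real a := by
    unfold regular at hA
    cases h : det A <;> simp_all [isReal]
  have hinv : dinv (det A) = real (-a) := by rw [ha]; rfl
  have hone : real a * real (-a) = 1 := by rw [mul_def, one_def]; simp [mul]
  have hone' : (a : WithBot ℝ) + (-a : ℝ) = 0 := by
    rw [← WithBot.coe_add]; simp
  have hpi : ∀ i j, pi ((A * pinv A) i j) = pi (replaceDet A i j) + (-a : ℝ) := fun i j => by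
    rw [mul_pinv_apply, pi_mul, hinv]; rfl
  have hdiag : ∀ i, (A * pinv A) i i = 1 := fun i => by
    rw [mul_pinv_apply, replaceDet_self, hinv, ha, hone]
  ext i j
  rw [Matrix.mul_apply, ← Finset.add_sum_erase _ _ (Finset.mem_univ i), hdiag, one_mul]
  rcases eq_or_ne i j with rfl | hij
  · refine add_eq_left_of_pi_lt ?_
    rw [pi_sum, hdiag]
    refine (Finset.sup_lt_iff (WithBot.bot_lt_coe 0)).2 fun k hk => ?_
    rw [pi_mul, hpi, hpi]
    have h := pi_replaceDet_add_lt ha (Finset.ne_of_mem_erase hk).symm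
    calc _ = (pi (replaceDet A i k) + pi (replaceDet A k i)) + ((-a : ℝ) + (-a : ℝ)) :=
          add_add_add_comm _ _ _ _
      _ < ((a : WithBot ℝ) + a) + ((-a : ℝ) + (-a : ℝ)) :=
          WithBot.add_lt_add_right (by simp [← WithBot.coe_add]) h
      _ = 0 := by rw [add_add_add_comm, hone', add_zero]
  · refine add_eq_left_of_isGhost ?_ ?_
    · have := isGhost_replaceDet A hij
      rw [mul_pinv_apply, hinv, mul_def]
      cases h : replaceDet A i j <;> simp_all [isGhost, mul]
    · rw [pi_sum]
      refine Finset.sup_le fun k _ => ?_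
      rw [pi_mul, hpi, hpi, hpi]
      have h := pi_replaceDet_add_le A i j k
      calc _ = (pi (replaceDet A i k) + pi (replaceDet A k j)) + ((-a : ℝ) + (-a : ℝ)) :=
            add_add_add_comm _ _ _ _
        _ ≤ ((a : WithBot ℝ) + pi (replaceDet A i j)) + ((-a : ℝ) + (-a : ℝ)) := by
            rw [ha] at h
            exact add_le_add_left h _
        _ = _ := by rw [add_add_add_comm, hone', zero_add]

lemma pinv_transpose {n : ℕ} (A : Matrix (Fin (n + 1)) (Fin (n + 1)) T) :
    pinv A.transpose = (pinv A).transpose := by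
  ext i j
  rw [Matrix.transpose_apply, pinv, pinv, det_transpose, adj, adj, ← det_transpose (minor A i j)]
  rfl

end T

/-- for tropically regular `A`, the products `A ⊙ A^∇` and `A^∇ ⊙ A`
are idempotent. -/
theorem matMul_pinv_idempotent {n : ℕ} (A : Matrix (Fin (n+1)) (Fin (n+1)) T)
    (hA : T.regular A) :
    T.matMul (T.matMul A (T.pinv A)) (T.matMul A (T.pinv A)) = T.matMul A (T.pinv A) ∧
    T.matMul (T.matMul (T.pinv A) A) (T.matMul (T.pinv A) A) = T.matMul (T.pinv A) A := by
  simp only [T.matMul_eq_mul]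
  refine ⟨T.isIdempotentElem_mul_pinv hA, ?_⟩
  have h := T.isIdempotentElem_mul_pinv (A := A.transpose) (by rwa [T.regular, T.det_transpose])
  rw [T.pinv_transpose, ← Matrix.transpose_mul, IsIdempotentElem, ← Matrix.transpose_mul] at h
  exact Matrix.transpose_injective h
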